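/- Fix an integer n ≥ 1. There exists a constant c(n) > 0 depending only on n with the following property. Let h : ℝ → ℝ be C² and let λ ∈ ℝ be such that, for all s ∈ ℝ: (i) −(4/n)(λ−1)h(s) + (λ−2)h'(s) + λ h''(s) ≥ 0; (ii) h(s)·(−(2/n)(λ²−1)h(s) − λ h'(s)) ≥ 0; (iii) λ h(s) ≥ 0. Then for every R > 0, every smooth positive solution u of Δu + u h(ln u) = 0 on the ball B_{2R} ⊂ ℝⁿ satisfies the Harnack inequality sup_{B_{R/2}} u ≤ e^{√(c(n))} · inf_{B_{R/2}} u. -/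

import Mathlib

open Real Metric

/-- The Euclidean Laplacian: trace of the Hessian. -/
noncomputable def lap {n : ℕ} (f : EuclideanSpace ℝ (Fin n) → ℝ)
    (x : EuclideanSpace ℝ (Fin n)) : ℝ :=
  ∑ i : Fin n,
    fderiv ℝ (fun y => fderiv ℝ f y (EuclideanSpace.single i 1)) x
      (EuclideanSpace.single i 1)

section PartialDerivatives

open Topology Filter

variable {n : ℕ}

/-- The `i`-th partial derivative of a function on Euclidean space. -/
noncomputable def partialDeriv (i : Fin n) (f : EuclideanSpace ℝ (Fin n) → ℝ)
    (x : EuclideanSpace ℝ (Fin n)) : ℝ :=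
  fderiv ℝ f x (EuclideanSpace.single i 1)

theorem lap_eq_sum_partialDeriv (f : EuclideanSpace ℝ (Fin n) → ℝ)
    (x : EuclideanSpace ℝ (Fin n)) :
    lap f x = ∑ i, partialDeriv i (partialDeriv i f) x := rfl

variable {f g : EuclideanSpace ℝ (Fin n) → ℝ} {x : EuclideanSpace ℝ (Fin n)}
  {s : Set (EuclideanSpace ℝ (Fin n))}

theorem partialDeriv_congr (i : Fin n) (hs : IsOpen s) (hfg : Set.EqOn f g s) (hx : x ∈ s) :
    partialDeriv i f x = partialDeriv i g x := by
  unfold partialDeriv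
  rw [(hfg.eventuallyEq_of_mem (hs.mem_nhds hx)).fderiv_eq]

theorem partialDeriv_add (i : Fin n) (hf : DifferentiableAt ℝ f x) (hg : DifferentiableAt ℝ g x) :
    partialDeriv i (fun y => f y + g y) x = partialDeriv i f x + partialDeriv i g x := by
  simp [partialDeriv, fderiv_fun_add hf hg]

theorem partialDeriv_mul (i : Fin n) (hf : DifferentiableAt ℝ f x) (hg : DifferentiableAt ℝ g x) :
    partialDeriv i (fun y => f y * g y) x = f x * partialDeriv i g x + partialDeriv i f x * g x := by
  simp [partialDeriv, fderiv_fun_mul hf hg, mul_comm]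

theorem partialDeriv_sq (i : Fin n) (hf : DifferentiableAt ℝ f x) :
    partialDeriv i (fun y => f y ^ 2) x = 2 * f x * partialDeriv i f x := by
  simp only [pow_two, partialDeriv_mul i hf hf]
  ring

theorem partialDeriv_const_mul (i : Fin n) (c : ℝ) (hf : DifferentiableAt ℝ f x) :
    partialDeriv i (fun y => c * f y) x = c * partialDeriv i f x := by
  simp [partialDeriv, fderiv_const_mul hf]

theorem partialDeriv_sum {ι : Type*} (t : Finset ι) (i : Fin n)
    {f : ι → EuclideanSpace ℝ (Fin n) → ℝ} (hf : ∀ j ∈ t, DifferentiableAt ℝ (f j) x) :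
    partialDeriv i (fun y => ∑ j ∈ t, f j y) x = ∑ j ∈ t, partialDeriv i (f j) x := by
  simp [partialDeriv, fderiv_fun_sum hf]

theorem partialDeriv_comp (i : Fin n) {h : ℝ → ℝ} (hh : DifferentiableAt ℝ h (f x))
    (hf : DifferentiableAt ℝ f x) :
    partialDeriv i (fun y => h (f y)) x = deriv h (f x) * partialDeriv i f x := by
  have := (hh.hasDerivAt.comp_hasFDerivAt x hf.hasFDerivAt).fderiv
  simp only [Function.comp_def] at this
  simp [partialDeriv, this]

theorem partialDeriv_coord (i j : Fin n) :
    partialDeriv i (fun y : EuclideanSpace ℝ (Fin n) => y j) x = if i = j then 1 else 0 := by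
  have : HasFDerivAt (fun y : EuclideanSpace ℝ (Fin n) => y j)
      (EuclideanSpace.proj j : EuclideanSpace ℝ (Fin n) →L[ℝ] ℝ) x :=
    (EuclideanSpace.proj j : EuclideanSpace ℝ (Fin n) →L[ℝ] ℝ).hasFDerivAt
  simp [partialDeriv, this.fderiv, eq_comm]

theorem ContDiffOn.partialDeriv {k m : WithTop ℕ∞} (hf : ContDiffOn ℝ k f s) (hs : IsOpen s)
    (hk : m + 1 ≤ k) (i : Fin n) : ContDiffOn ℝ m (partialDeriv i f) s :=
  (hf.fderiv_of_isOpen hs hk).clm_apply contDiffOn_const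

theorem partialDeriv_comm (hf : ContDiffAt ℝ 2 f x) (i j : Fin n) :
    partialDeriv i (partialDeriv j f) x = partialDeriv j (partialDeriv i f) x := by
  have hd : DifferentiableAt ℝ (fderiv ℝ f) x :=
    (hf.fderiv_right (m := 1) (by norm_num)).differentiableAt (by norm_num)
  have key (a b : Fin n) : partialDeriv a (partialDeriv b f) x =
      fderiv ℝ (fderiv ℝ f) x (EuclideanSpace.single a 1) (EuclideanSpace.single b 1) := by
    unfold partialDeriv
    rw [fderiv_clm_apply hd (by fun_prop)]
    simp
  rw [key, key]
  exact (hf.isSymmSndFDerivAt (by simp)).eq _ _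

/-- The second derivative of a real function is nonpositive at a local maximum. -/
theorem IsLocalMax.deriv_deriv_nonpos {g : ℝ → ℝ} {a : ℝ} (hmax : IsLocalMax g a)
    (hg : ContinuousAt g a) : deriv (deriv g) a ≤ 0 := by
  by_contra! hpos
  have hmin := isLocalMin_of_deriv_deriv_pos hpos hmax.deriv_eq_zero hg
  have hconst : g =ᶠ[𝓝 a] fun _ => g a := by
    filter_upwards [hmax, hmin] with y h1 h2 using le_antisymm h1 h2
  have := hconst.deriv.deriv_eq
  simp at this
  linarith

theorem IsLocalMax.partialDeriv_partialDeriv_nonpos (hmax : IsLocalMax f x)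
    (hf : ContDiffAt ℝ 2 f x) (i : Fin n) : partialDeriv i (partialDeriv i f) x ≤ 0 := by
  set e : EuclideanSpace ℝ (Fin n) := EuclideanSpace.single i 1
  set l : ℝ → EuclideanSpace ℝ (Fin n) := fun t => x + t • e
  have hl (t : ℝ) : HasDerivAt l e t := by
    have := ((hasDerivAt_id t).smul_const e).const_add x
    rw [one_smul] at this
    exact this
  have hl0 : l 0 = x := by simp [l]
  have hlt : Tendsto l (𝓝 0) (𝓝 x) := by
    simpa [hl0] using (hl 0).continuousAt.tendsto
  have hmax' : IsLocalMax (f ∘ l) 0 := by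
    have := hlt.eventually hmax
    simpa [IsLocalMax, IsMaxFilter, hl0] using this
  have hev : ∀ᶠ t in 𝓝 (0 : ℝ), deriv (f ∘ l) t = partialDeriv i f (l t) := by
    have h1 : ∀ᶠ y in 𝓝 x, ContDiffAt ℝ 2 f y := hf.eventually (by simp)
    filter_upwards [hlt.eventually h1] with t ht
    exact ((ht.differentiableAt (by norm_num)).hasFDerivAt.comp_hasDerivAt t (hl t)).deriv
  have hd : DifferentiableAt ℝ (partialDeriv i f) x :=
    ((hf.fderiv_right (m := 1) (by norm_num)).clm_apply contDiffAt_const).differentiableAt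
      (by norm_num)
  have h2 : deriv (deriv (f ∘ l)) 0 = partialDeriv i (partialDeriv i f) x := by
    rw [EventuallyEq.deriv_eq hev]
    have hd' := hd.hasFDerivAt
    rw [← hl0] at hd'
    have := (hd'.comp_hasDerivAt 0 (hl 0)).deriv
    rw [hl0] at this
    exact this
  rw [← h2]
  refine hmax'.deriv_deriv_nonpos ?_
  refine ContinuousAt.comp ?_ (hl 0).continuousAt
  rw [hl0]
  exact hf.continuousAt

theorem norm_fderiv_le_of_sum_sq_partialDeriv_le {C : ℝ} (hC : 0 ≤ C)
    (h : ∑ j, partialDeriv j f x ^ 2 ≤ C ^ 2) : ‖fderiv ℝ f x‖ ≤ C := by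
  refine ContinuousLinearMap.opNorm_le_bound _ hC fun z => ?_
  have hz : fderiv ℝ f x z = ∑ j, z j * partialDeriv j f x := by
    conv_lhs => rw [← (EuclideanSpace.basisFun (Fin n) ℝ).sum_repr z]
    simp [partialDeriv]
  have h1 := Finset.sum_mul_sq_le_sq_mul_sq Finset.univ (fun j => z j)
    (fun j => partialDeriv j f x)
  rw [hz, Real.norm_eq_abs]
  refine abs_le_of_sq_le_sq (h1.trans ?_) (by positivity)
  rw [mul_pow, mul_comm, EuclideanSpace.real_norm_sq_eq]
  gcongr

end PartialDerivatives

section Bernstein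

open Topology Filter

variable {n : ℕ}

theorem sq_sum_diag_le (A : Fin n → Fin n → ℝ) :
    (∑ i, A i i) ^ 2 ≤ n * ∑ i, ∑ j, A i j ^ 2 := by
  have h1 : (∑ i, A i i) ^ 2 ≤ n * ∑ i, A i i ^ 2 := by
    simpa using sq_sum_le_card_mul_sum_sq (s := Finset.univ) (f := fun i => A i i)
  refine h1.trans ?_
  gcongr with i
  exact Finset.single_le_sum (f := fun j => A i j ^ 2) (fun _ _ => sq_nonneg _) (Finset.mem_univ i)

variable {v : EuclideanSpace ℝ (Fin n) → ℝ} {x : EuclideanSpace ℝ (Fin n)}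
  {s : Set (EuclideanSpace ℝ (Fin n))} {h : ℝ → ℝ} {lam : ℝ}

/-- If `u` is a positive solution of `Δu + u h(log u) = 0`, then `v = log u` solves
`Δv + |∇v|² + h(v) = 0`. -/
theorem lap_log {u : EuclideanSpace ℝ (Fin n) → ℝ} (hs : IsOpen s) (hu : ContDiffOn ℝ 2 u s)
    (hpos : ∀ x ∈ s, 0 < u x) (heq : ∀ x ∈ s, lap u x + u x * h (Real.log (u x)) = 0)
    (hx : x ∈ s) :
    lap (fun y => Real.log (u y)) x =
      -(∑ j, partialDeriv j (fun y => Real.log (u y)) x ^ 2) - h (Real.log (u x)) := by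
  have hd : ∀ y ∈ s, DifferentiableAt ℝ u y := fun y hy =>
    (hu.differentiableOn (by norm_num)).differentiableAt (hs.mem_nhds hy)
  have hv : ContDiffOn ℝ 2 (fun y => Real.log (u y)) s := hu.log fun y hy => (hpos y hy).ne'
  have h1 (i : Fin n) : Set.EqOn (partialDeriv i u)
      (fun y => u y * partialDeriv i (fun y => Real.log (u y)) y) s := by
    intro y hy
    have := partialDeriv_comp i (Real.differentiableAt_log (hpos y hy).ne') (hd y hy)
    have h0 := (hpos y hy).ne'
    simp only [this, Real.deriv_log]
    field_simp
  have h2 (i : Fin n) : partialDeriv i (partialDeriv i u) x =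
      u x * (partialDeriv i (partialDeriv i (fun y => Real.log (u y))) x +
        partialDeriv i (fun y => Real.log (u y)) x ^ 2) := by
    rw [partialDeriv_congr i hs (h1 i) hx, partialDeriv_mul i (hd x hx)
      (((hv.partialDeriv hs (m := 1) (by norm_num) i).differentiableOn
        (by norm_num)).differentiableAt (hs.mem_nhds hx)), h1 i hx]
    ring
  have h3 := heq x hx
  rw [lap_eq_sum_partialDeriv] at h3 ⊢
  simp only [h2] at h3
  rw [← Finset.mul_sum, ← mul_add, mul_eq_zero, Finset.sum_add_distrib] at h3
  rcases h3 with h3 | h3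
  · exact absurd h3 (hpos x hx).ne'
  · linarith

/-- The Bernstein-type differential inequality for `F = |∇v|² + λ h(v)`. -/
theorem lap_bernstein_ge (hn : 1 ≤ n) (hs : IsOpen s) (hv : ContDiffOn ℝ (⊤ : ℕ∞) v s)
    (hh : ContDiff ℝ 2 h)
    (h₁ : ∀ s : ℝ, -(4 / (n : ℝ)) * (lam - 1) * h s + (lam - 2) * deriv h s
      + lam * deriv (deriv h) s ≥ 0)
    (h₂ : ∀ s : ℝ, h s * (-(2 / (n : ℝ)) * (lam ^ 2 - 1) * h s - lam * deriv h s) ≥ 0)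
    (heq : ∀ x ∈ s, lap v x = -(∑ j, partialDeriv j v x ^ 2) - h (v x)) (hx : x ∈ s) :
    2 / n * (∑ j, partialDeriv j v x ^ 2 + lam * h (v x)) ^ 2
      - 2 * ∑ i, partialDeriv i v x *
        partialDeriv i (fun y => ∑ j, partialDeriv j v y ^ 2 + lam * h (v y)) x ≤
    lap (fun y => ∑ j, partialDeriv j v y ^ 2 + lam * h (v y)) x := by
  have htop : (2 : WithTop ℕ∞) ≤ ((⊤ : ℕ∞) : WithTop ℕ∞) :=
    WithTop.coe_le_coe.2 (le_top : (2 : ℕ∞) ≤ ⊤)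
  have hD {f : EuclideanSpace ℝ (Fin n) → ℝ} (hf : ContDiffOn ℝ (⊤ : ℕ∞) f s) {y}
      (hy : y ∈ s) : DifferentiableAt ℝ f y :=
    (hf.differentiableOn (by norm_num)).differentiableAt (hs.mem_nhds hy)
  have hv1 (i : Fin n) : ContDiffOn ℝ (⊤ : ℕ∞) (partialDeriv i v) s :=
    hv.partialDeriv hs (by norm_num) i
  have hv2 (i j : Fin n) : ContDiffOn ℝ (⊤ : ℕ∞) (partialDeriv i (partialDeriv j v)) s :=
    (hv1 j).partialDeriv hs (by norm_num) i
  have hh0 : Differentiable ℝ h := hh.differentiable (by norm_num)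
  have hh1 : Differentiable ℝ (deriv h) :=
    (hh.deriv' (n := 1)).differentiable (by norm_num)
  have hv2at {y} (hy : y ∈ s) : ContDiffAt ℝ 2 v y :=
    (hv.contDiffAt (hs.mem_nhds hy)).of_le htop
  have hhv {y} (hy : y ∈ s) : DifferentiableAt ℝ (fun y => h (v y)) y :=
    (hh0 _).comp y (hD hv hy)
  have hh1v {y} (hy : y ∈ s) : DifferentiableAt ℝ (fun y => deriv h (v y)) y :=
    (hh1 _).comp y (hD hv hy)
  have hsq {y} (hy : y ∈ s) (j : Fin n) : DifferentiableAt ℝ (fun y => partialDeriv j v y ^ 2) y :=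
    (hD (hv1 j) hy).pow 2
  have hsum {y} (hy : y ∈ s) : DifferentiableAt ℝ (fun y => ∑ j, partialDeriv j v y ^ 2) y :=
    DifferentiableAt.fun_sum fun j _ => hsq hy j
  have dF (i : Fin n) : Set.EqOn
      (partialDeriv i (fun y => ∑ j, partialDeriv j v y ^ 2 + lam * h (v y)))
      (fun y => ∑ j, 2 * (partialDeriv j v y * partialDeriv i (partialDeriv j v) y) +
        lam * (deriv h (v y) * partialDeriv i v y)) s := by
    intro y hy
    rw [partialDeriv_add i (hsum hy) ((hhv hy).const_mul lam),
      partialDeriv_sum _ i fun j _ => hsq hy j, partialDeriv_const_mul i lam (hhv hy),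
      partialDeriv_comp i (hh0 _) (hD hv hy)]
    simp only [partialDeriv_sq i (hD (hv1 _) hy), mul_assoc]
  have ddF (i : Fin n) :
      partialDeriv i (partialDeriv i (fun y => ∑ j, partialDeriv j v y ^ 2 + lam * h (v y))) x =
      ∑ j, 2 * (partialDeriv j v x * partialDeriv i (partialDeriv i (partialDeriv j v)) x +
        partialDeriv i (partialDeriv j v) x * partialDeriv i (partialDeriv j v) x) +
      lam * (deriv h (v x) * partialDeriv i (partialDeriv i v) x +
        deriv (deriv h) (v x) * partialDeriv i v x * partialDeriv i v x) := by
    have hm (j : Fin n) : DifferentiableAt ℝ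
        (fun y => partialDeriv j v y * partialDeriv i (partialDeriv j v) y) x :=
      (hD (hv1 j) hx).mul (hD (hv2 i j) hx)
    have hm' : DifferentiableAt ℝ (fun y => deriv h (v y) * partialDeriv i v y) x :=
      (hh1v hx).mul (hD (hv1 i) hx)
    rw [partialDeriv_congr i hs (dF i) hx, partialDeriv_add i
      (DifferentiableAt.fun_sum fun j _ => (hm j).const_mul 2) (hm'.const_mul lam),
      partialDeriv_sum _ i fun j _ => (hm j).const_mul 2, partialDeriv_const_mul i lam hm',
      partialDeriv_mul i (hh1v hx) (hD (hv1 i) hx), partialDeriv_comp i (hh1 _) (hD hv hx)]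
    simp only [partialDeriv_const_mul i 2 (hm _),
      partialDeriv_mul i (hD (hv1 _) hx) (hD (hv2 _ _) hx)]
  have third (j : Fin n) : ∑ i, partialDeriv i (partialDeriv i (partialDeriv j v)) x =
      -partialDeriv j (fun y => ∑ j, partialDeriv j v y ^ 2 + lam * h (v y)) x
        + (lam - 1) * (deriv h (v x) * partialDeriv j v x) := by
    have e1 (i : Fin n) : partialDeriv i (partialDeriv i (partialDeriv j v)) x =
        partialDeriv j (partialDeriv i (partialDeriv i v)) x := by
      rw [partialDeriv_congr i hs (fun y hy => partialDeriv_comm (hv2at hy) i j) hx,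
        partialDeriv_comm (((hv1 i).contDiffAt (hs.mem_nhds hx)).of_le htop) i j]
    simp only [e1]
    rw [← partialDeriv_sum _ j fun i _ => hD (hv2 i i) hx]
    have e2 : Set.EqOn (fun y => ∑ i, partialDeriv i (partialDeriv i v) y)
        (fun y => (-1) * (∑ j, partialDeriv j v y ^ 2 + lam * h (v y)) + (lam - 1) * h (v y)) s := by
      intro y hy
      have := heq y hy
      rw [lap_eq_sum_partialDeriv] at this
      simp only [this]
      ring
    have hFd := (hsum hx).fun_add ((hhv hx).const_mul lam)
    rw [partialDeriv_congr j hs e2 hx,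
      partialDeriv_add j (hFd.const_mul (-1)) ((hhv hx).const_mul _),
      partialDeriv_const_mul j _ hFd, partialDeriv_const_mul j _ (hhv hx),
      partialDeriv_comp j (hh0 _) (hD hv hx)]
    ring
  have htr := sq_sum_diag_le fun i j => partialDeriv i (partialDeriv j v) x
  have heqx := heq x hx
  rw [lap_eq_sum_partialDeriv] at heqx
  rw [heqx] at htr
  have hlap : lap (fun y => ∑ j, partialDeriv j v y ^ 2 + lam * h (v y)) x =
      2 * (∑ i, ∑ j, partialDeriv i (partialDeriv j v) x ^ 2)
      - 2 * ∑ i, partialDeriv i v x *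
        partialDeriv i (fun y => ∑ j, partialDeriv j v y ^ 2 + lam * h (v y)) x
      + 2 * (lam - 1) * deriv h (v x) * (∑ j, partialDeriv j v x ^ 2)
      + lam * deriv h (v x) * (∑ i, partialDeriv i (partialDeriv i v) x)
      + lam * deriv (deriv h) (v x) * (∑ j, partialDeriv j v x ^ 2) := by
    have e3 : ∑ i, ∑ j, partialDeriv j v x * partialDeriv i (partialDeriv i (partialDeriv j v)) x
        = ∑ j, partialDeriv j v x *
          (-partialDeriv j (fun y => ∑ j, partialDeriv j v y ^ 2 + lam * h (v y)) x
            + (lam - 1) * (deriv h (v x) * partialDeriv j v x)) := by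
      rw [Finset.sum_comm]
      simp only [← third, Finset.mul_sum]
    have e4 : ∑ j, partialDeriv j v x *
          (-partialDeriv j (fun y => ∑ j, partialDeriv j v y ^ 2 + lam * h (v y)) x
            + (lam - 1) * (deriv h (v x) * partialDeriv j v x)) =
        -(∑ i, partialDeriv i v x *
          partialDeriv i (fun y => ∑ j, partialDeriv j v y ^ 2 + lam * h (v y)) x)
        + (lam - 1) * deriv h (v x) * (∑ j, partialDeriv j v x ^ 2) := by
      rw [Finset.mul_sum, ← Finset.sum_neg_distrib, ← Finset.sum_add_distrib]
      exact Finset.sum_congr rfl fun j _ => by ring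
    rw [lap_eq_sum_partialDeriv]
    simp only [ddF, Finset.sum_add_distrib, ← Finset.mul_sum]
    rw [e3, e4]
    simp only [← pow_two, mul_assoc, ← Finset.mul_sum]
    ring
  rw [hlap, heqx]
  set w := ∑ j, partialDeriv j v x ^ 2
  have hw0 : 0 ≤ w := Finset.sum_nonneg fun _ _ => sq_nonneg _
  have hn0 : (0 : ℝ) < n := by exact_mod_cast hn
  have a1 := mul_nonneg hw0 (h₁ (v x))
  have a2 := h₂ (v x)
  have a3 : 2 / n * (-w - h (v x)) ^ 2 ≤
      2 * ∑ i, ∑ j, partialDeriv i (partialDeriv j v) x ^ 2 := by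
    rw [div_mul_eq_mul_div, div_le_iff₀ hn0]
    linarith
  have a4 : 2 / (n : ℝ) * (-w - h (v x)) ^ 2 = 2 / n * (w + lam * h (v x)) ^ 2
      - (4 / n) * (lam - 1) * h (v x) * w - 2 / n * (lam ^ 2 - 1) * h (v x) * h (v x) := by
    ring
  linarith

theorem partialDeriv_sq_sub_sum_sq (R : ℝ) (i : Fin n) (y : EuclideanSpace ℝ (Fin n)) :
    partialDeriv i (fun y => R ^ 2 - ∑ j, y j ^ 2) y = -2 * y i := by
  have hc (j : Fin n) : DifferentiableAt ℝ (fun y : EuclideanSpace ℝ (Fin n) => y j) y := by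
    fun_prop
  have e : (fun y : EuclideanSpace ℝ (Fin n) => R ^ 2 - ∑ j, y j ^ 2) =
      fun y => (R ^ 2 : ℝ) + (-1) * ∑ j, y j ^ 2 := by
    ext y; ring
  rw [e, partialDeriv_add i (by fun_prop) (by fun_prop),
    partialDeriv_const_mul i _ (by fun_prop), partialDeriv_sum _ i fun j _ => (hc j).fun_pow 2]
  simp only [partialDeriv_sq i (hc _), partialDeriv_coord]
  simp [partialDeriv]

/-- Localized maximum principle: a nonnegative function satisfying
`ΔF ≥ (2/n) F² - 2⟨X, ∇F⟩` with `|X|² ≤ F` on a neighbourhood of the closed ball of radius `R`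
is controlled in the interior. -/
theorem cutoff_mul_le (hn : 1 ≤ n) {R : ℝ} (hR : 0 < R) (hs : IsOpen s)
    (hsub : closedBall (0 : EuclideanSpace ℝ (Fin n)) R ⊆ s)
    {F : EuclideanSpace ℝ (Fin n) → ℝ} (hF : ContDiffOn ℝ 2 F s)
    {X : EuclideanSpace ℝ (Fin n) → Fin n → ℝ} (hX : ∀ x ∈ s, ∑ j, X x j ^ 2 ≤ F x)
    (hlap : ∀ x ∈ s, 2 / n * F x ^ 2 - 2 * ∑ j, X x j * partialDeriv j F x ≤ lap F x)
    (hx : x ∈ closedBall (0 : EuclideanSpace ℝ (Fin n)) R) :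
    (R ^ 2 - ∑ j, x j ^ 2) ^ 2 * F x ≤ (24 * n + 20 * n ^ 2) * R ^ 2 := by
  set ψ : EuclideanSpace ℝ (Fin n) → ℝ := fun y => R ^ 2 - ∑ j, y j ^ 2 with hψ
  have hn0 : (0 : ℝ) < n := by exact_mod_cast hn
  have hψC : ContDiff ℝ 2 ψ := by
    simp only [hψ]
    fun_prop
  have hψd (y) : DifferentiableAt ℝ ψ y := (hψC.differentiable (by norm_num)) y
  have hGC : ContDiffOn ℝ 2 (fun y => ψ y ^ 2 * F y) s := (hψC.contDiffOn.pow 2).mul hF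
  obtain ⟨x₀, hx₀, hmax⟩ := (isCompact_closedBall (0 : EuclideanSpace ℝ (Fin n)) R).exists_isMaxOn
    ⟨x, hx⟩ (hGC.continuousOn.mono hsub)
  refine (hmax hx).trans ?_
  have hF0 (y) (hy : y ∈ s) : 0 ≤ F y := (Finset.sum_nonneg fun _ _ => sq_nonneg _).trans (hX y hy)
  by_cases hG0 : ψ x₀ ^ 2 * F x₀ ≤ 0
  · exact hG0.trans (by positivity)
  have hx₀s := hsub hx₀
  have hψ0 : ψ x₀ ≠ 0 := by
    rintro h0
    simp [h0] at hG0
  have hFpos : 0 < F x₀ := by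
    refine lt_of_le_of_ne (hF0 x₀ hx₀s) fun h0 => hG0 ?_
    simp [← h0]
  have hr : ∑ j, x₀ j ^ 2 = ‖x₀‖ ^ 2 := (EuclideanSpace.real_norm_sq_eq x₀).symm
  have hxn : ‖x₀‖ ≤ R := by simpa using hx₀
  have hψpos : 0 < ψ x₀ := by
    refine lt_of_le_of_ne ?_ hψ0.symm
    simp only [hψ, hr]
    nlinarith [norm_nonneg x₀]
  have hxlt : ‖x₀‖ < R := by
    refine lt_of_le_of_ne hxn fun h0 => hψ0 ?_
    simp [hψ, hr, h0]
  have hloc : IsLocalMax (fun y => ψ y ^ 2 * F y) x₀ :=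
    hmax.isLocalMax (Filter.mem_of_superset (isOpen_ball.mem_nhds (by simpa using hxlt))
      ball_subset_closedBall)
  have hFd {y} (hy : y ∈ s) : DifferentiableAt ℝ F y :=
    (hF.differentiableOn (by norm_num)).differentiableAt (hs.mem_nhds hy)
  have hDFd (i : Fin n) {y} (hy : y ∈ s) : DifferentiableAt ℝ (partialDeriv i F) y :=
    ((hF.partialDeriv hs (m := 1) (by norm_num) i).differentiableOn
      (by norm_num)).differentiableAt (hs.mem_nhds hy)
  have hDψ (i : Fin n) (y) : partialDeriv i ψ y = -2 * y i := partialDeriv_sq_sub_sum_sq R i y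
  have hDG (i : Fin n) : Set.EqOn (partialDeriv i (fun y => ψ y ^ 2 * F y))
      (fun y => ψ y ^ 2 * partialDeriv i F y + (-4) * (y i * ψ y) * F y) s := by
    intro y hy
    rw [partialDeriv_mul i ((hψd y).fun_pow 2) (hFd hy), partialDeriv_sq i (hψd y), hDψ]
    ring
  have grad (i : Fin n) : ψ x₀ * partialDeriv i F x₀ = 4 * x₀ i * F x₀ := by
    have h1 : partialDeriv i (fun y => ψ y ^ 2 * F y) x₀ = 0 := by
      unfold partialDeriv
      rw [hloc.fderiv_eq_zero]
      simp
    rw [hDG i hx₀s] at h1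
    apply mul_left_cancel₀ hψ0
    linear_combination h1
  have hess (i : Fin n) : ψ x₀ ^ 2 * partialDeriv i (partialDeriv i F) x₀ ≤
      F x₀ * (24 * x₀ i ^ 2 + 4 * ψ x₀) := by
    have h1 := hloc.partialDeriv_partialDeriv_nonpos (hGC.contDiffAt (hs.mem_nhds hx₀s)) i
    have hc : DifferentiableAt ℝ (fun y : EuclideanSpace ℝ (Fin n) => y i) x₀ := by fun_prop
    have h2 := hc.fun_mul (hψd x₀)
    rw [partialDeriv_congr i hs (hDG i) hx₀s,
      partialDeriv_add i (((hψd x₀).fun_pow 2).fun_mul (hDFd i hx₀s))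
        ((h2.const_mul (-4)).fun_mul (hFd hx₀s)),
      partialDeriv_mul i ((hψd x₀).fun_pow 2) (hDFd i hx₀s),
      partialDeriv_mul i (h2.const_mul (-4)) (hFd hx₀s), partialDeriv_sq i (hψd x₀), hDψ,
      partialDeriv_const_mul i _ h2, partialDeriv_mul i hc (hψd x₀), hDψ, partialDeriv_coord] at h1
    simp only [if_true] at h1
    linear_combination h1 + 8 * x₀ i * grad i
  have hsum : ψ x₀ ^ 2 * lap F x₀ ≤ F x₀ * (24 * ‖x₀‖ ^ 2 + 4 * n * ψ x₀) := by
    have := Finset.sum_le_sum fun i (_ : i ∈ Finset.univ) => hess i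
    rw [lap_eq_sum_partialDeriv, Finset.mul_sum]
    refine this.trans_eq ?_
    rw [← Finset.mul_sum, Finset.sum_add_distrib, ← Finset.mul_sum, hr]
    simp only [Finset.sum_const, Finset.card_univ, Fintype.card_fin, nsmul_eq_mul]
    ring
  have hXF : ψ x₀ * ∑ j, X x₀ j * partialDeriv j F x₀ = 4 * F x₀ * ∑ j, X x₀ j * x₀ j := by
    rw [Finset.mul_sum, Finset.mul_sum]
    exact Finset.sum_congr rfl fun j _ => by linear_combination X x₀ j * grad j
  have hCS : (∑ j, X x₀ j * x₀ j) ^ 2 ≤ F x₀ * ‖x₀‖ ^ 2 := by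
    refine (Finset.sum_mul_sq_le_sq_mul_sq _ _ _).trans ?_
    rw [hr]
    gcongr
    exact hX x₀ hx₀s
  set p := ∑ j, X x₀ j * x₀ j
  have h1 := mul_le_mul_of_nonneg_left (hlap x₀ hx₀s) (sq_nonneg (ψ x₀))
  have h2 : F x₀ * (2 / n * (ψ x₀ ^ 2 * F x₀) - 8 * ψ x₀ * p) ≤
      F x₀ * (24 * ‖x₀‖ ^ 2 + 4 * n * ψ x₀) := by
    linear_combination h1 + hsum + 2 * ψ x₀ * hXF
  have h3 := le_of_mul_le_mul_left h2 hFpos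
  have hψR : ψ x₀ ≤ R ^ 2 := by
    simp only [hψ, hr]
    nlinarith [sq_nonneg ‖x₀‖]
  have hnR : ‖x₀‖ ^ 2 ≤ R ^ 2 := by gcongr
  have h4 : 2 * (ψ x₀ ^ 2 * F x₀) - 8 * n * ψ x₀ * p ≤ (24 * n + 4 * n ^ 2) * R ^ 2 := by
    have h5 := mul_le_mul_of_nonneg_left h3 hn0.le
    have h6 : (n : ℝ) * (2 / n * (ψ x₀ ^ 2 * F x₀) - 8 * ψ x₀ * p) =
      2 * (ψ x₀ ^ 2 * F x₀) - 8 * n * ψ x₀ * p := by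
      field_simp
    have h7 := mul_le_mul_of_nonneg_left hnR hn0.le
    have h8 := mul_le_mul_of_nonneg_left hψR (sq_nonneg (n : ℝ))
    linarith
  have hq : 8 * n * ψ x₀ * p ≤ ψ x₀ ^ 2 * F x₀ + 16 * n ^ 2 * R ^ 2 := by
    have hp : (ψ x₀ * p) ^ 2 ≤ (ψ x₀ ^ 2 * F x₀) * R ^ 2 := by
      calc (ψ x₀ * p) ^ 2 = ψ x₀ ^ 2 * p ^ 2 := by ring
        _ ≤ ψ x₀ ^ 2 * (F x₀ * R ^ 2) := by
          gcongr
          exact hCS.trans (by gcongr)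
        _ = _ := by ring
    have hT : 0 ≤ ψ x₀ ^ 2 * F x₀ := by positivity
    have hsq : (8 * n * ψ x₀ * p) ^ 2 ≤ (ψ x₀ ^ 2 * F x₀ + 16 * n ^ 2 * R ^ 2) ^ 2 := by
      have := mul_le_mul_of_nonneg_left hp (sq_nonneg (8 * n : ℝ))
      nlinarith [sq_nonneg (ψ x₀ ^ 2 * F x₀ - 16 * n ^ 2 * R ^ 2)]
    exact le_of_abs_le (abs_le_of_sq_le_sq hsq (by positivity))
  linarith

end Bernstein

/-- Corollary 1.1 (Euclidean case `K = 0`): Harnack inequality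
`sup_{B_{R/2}} u ≤ e^{√(c(n))} · inf_{B_{R/2}} u` for positive solutions of
`Δu + u h(ln u) = 0` under the structural conditions (1.9) on `h` and `λ`. -/
theorem stmt_5 (n : ℕ) (hn : 1 ≤ n) :
    ∃ c : ℝ, 0 < c ∧
      ∀ (h : ℝ → ℝ) (lam : ℝ), ContDiff ℝ 2 h →
        (∀ s : ℝ, -(4 / (n : ℝ)) * (lam - 1) * h s + (lam - 2) * deriv h s
            + lam * deriv (deriv h) s ≥ 0) →
        (∀ s : ℝ, h s * (-(2 / (n : ℝ)) * (lam ^ 2 - 1) * h s - lam * deriv h s) ≥ 0) →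
        (∀ s : ℝ, lam * h s ≥ 0) →
        ∀ R : ℝ, 0 < R →
          ∀ u : EuclideanSpace ℝ (Fin n) → ℝ,
            ContDiffOn ℝ (⊤ : ℕ∞) u (ball (0 : EuclideanSpace ℝ (Fin n)) (2 * R)) →
            (∀ x ∈ ball (0 : EuclideanSpace ℝ (Fin n)) (2 * R), 0 < u x) →
            (∀ x ∈ ball (0 : EuclideanSpace ℝ (Fin n)) (2 * R),
              lap u x + u x * h (Real.log (u x)) = 0) →
            ∀ x ∈ ball (0 : EuclideanSpace ℝ (Fin n)) (R / 2),
              ∀ y ∈ ball (0 : EuclideanSpace ℝ (Fin n)) (R / 2),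
                u x ≤ Real.exp (Real.sqrt c) * u y := by
  have hn0 : (0 : ℝ) < n := by exact_mod_cast hn
  set c : ℝ := 16 / 9 * (24 * n + 20 * n ^ 2) with hc
  have hc0 : 0 < c := by positivity
  refine ⟨c, hc0, ?_⟩
  intro h lam hh h₁ h₂ h₃ R hR u hu hpos heq x hx y hy
  set s := ball (0 : EuclideanSpace ℝ (Fin n)) (2 * R)
  have hs : IsOpen s := isOpen_ball
  have htop : (2 : WithTop ℕ∞) ≤ ((⊤ : ℕ∞) : WithTop ℕ∞) :=
    WithTop.coe_le_coe.2 (le_top : (2 : ℕ∞) ≤ ⊤)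
  set v : EuclideanSpace ℝ (Fin n) → ℝ := fun y => Real.log (u y)
  have hv : ContDiffOn ℝ (⊤ : ℕ∞) v s := hu.log fun y hy => (hpos y hy).ne'
  have hveq : ∀ x ∈ s, lap v x = -(∑ j, partialDeriv j v x ^ 2) - h (v x) := fun x hx =>
    lap_log hs (hu.of_le htop) hpos heq hx
  have hF : ContDiffOn ℝ 2 (fun y => ∑ j, partialDeriv j v y ^ 2 + lam * h (v y)) s :=
    (ContDiffOn.sum fun j _ => ((hv.partialDeriv hs (m := (⊤ : ℕ∞))
      (by norm_num) j).of_le htop).pow 2).add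
      (contDiffOn_const.mul (hh.comp_contDiffOn (hv.of_le htop)))
  have hgrad (z) (hz : z ∈ ball (0 : EuclideanSpace ℝ (Fin n)) (R / 2)) :
      ‖fderiv ℝ v z‖ ≤ Real.sqrt c / R := by
    have hzn : ‖z‖ < R / 2 := by simpa using hz
    refine norm_fderiv_le_of_sum_sq_partialDeriv_le (by positivity) ?_
    have hb := cutoff_mul_le hn hR hs (closedBall_subset_ball (by linarith)) hF
      (X := fun x j => partialDeriv j v x)
      (fun x _ => le_add_of_nonneg_right (h₃ (v x)))
      (fun x hx => lap_bernstein_ge hn hs hv hh h₁ h₂ hveq hx) (x := z)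
      (mem_closedBall_zero_iff.2 (by linarith))
    rw [← EuclideanSpace.real_norm_sq_eq z] at hb
    have hw : ∑ j, partialDeriv j v z ^ 2 ≤ ∑ j, partialDeriv j v z ^ 2 + lam * h (v z) :=
      le_add_of_nonneg_right (h₃ (v z))
    have hw0 : 0 ≤ ∑ j, partialDeriv j v z ^ 2 := Finset.sum_nonneg fun _ _ => sq_nonneg _
    have hz2 : 3 / 4 * R ^ 2 ≤ R ^ 2 - ‖z‖ ^ 2 := by nlinarith [norm_nonneg z]
    have h4 : (3 / 4 * R ^ 2) ^ 2 * ∑ j, partialDeriv j v z ^ 2 ≤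
        (24 * n + 20 * n ^ 2) * R ^ 2 := by
      refine le_trans ?_ hb
      gcongr
    rw [div_pow, Real.sq_sqrt hc0.le, le_div_iff₀ (by positivity)]
    have hR2 : 0 < R ^ 2 := by positivity
    refine le_of_mul_le_mul_left ?_ hR2
    rw [hc]
    linarith
  have hsub : ball (0 : EuclideanSpace ℝ (Fin n)) (R / 2) ⊆ s := ball_subset_ball (by linarith)
  have hlip := (convex_ball 0 (R / 2)).norm_image_sub_le_of_norm_fderiv_le
    (𝕜 := ℝ) (f := v) (fun z hz => (hv.differentiableOn (by norm_num)).differentiableAt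
      (hs.mem_nhds (hsub hz))) hgrad hy hx
  have hxy : ‖x - y‖ ≤ R := by
    have h1 : ‖x‖ < R / 2 := by simpa using hx
    have h2 : ‖y‖ < R / 2 := by simpa using hy
    linarith [norm_sub_le x y]
  have hle : v x ≤ Real.sqrt c + v y := by
    have : Real.sqrt c / R * ‖x - y‖ ≤ Real.sqrt c := by
      calc Real.sqrt c / R * ‖x - y‖ ≤ Real.sqrt c / R * R := by gcongr
        _ = _ := by field_simp
    linarith [(Real.le_norm_self _).trans hlip]
  have := Real.exp_le_exp.2 hle
  rwa [Real.exp_add, Real.exp_log (hpos x (hsub hx)), Real.exp_log (hpos y (hsub hy))] at this
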